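/- arXiv:1705.04138 — 5 statements merged into one kernel-verified Lean document; each statement's English description precedes it below -/
import Mathlib

section
/- Let F : ℝ^q → ℝ be convex and differentiable with ∇F being L_F-Lipschitz (‖∇F(x) − ∇F(y)‖ ≤ L_F·‖x − y‖ for all x, y), where L_F > 0. Let d, w, x_k, x_star ∈ ℝ^q, let 0 < η ≤ 1/L_F, set μ := d + w and x_{k+1} := x_k − η·μ. Then −2η·⟨μ, x_k − x_star⟩ + η²·‖μ‖² ≤ −2η·(F(x_{k+1}) − F(x_star)) − 2η·⟨d − ∇F(x_k), x_{k+1} − x_star⟩ + 2η·⟨w, x_star − x_{k+1}⟩. -/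
open scoped RealInnerProductSpace

section GradientBounds

variable {E : Type*} [NormedAddCommGroup E] [InnerProductSpace ℝ E] [CompleteSpace E]
  {F : E → ℝ}

theorem hasDerivAt_comp_add_smul_inner_gradient (hdiff : Differentiable ℝ F) (x v : E) (t : ℝ) :
    HasDerivAt (fun s : ℝ => F (x + s • v)) ⟪gradient F (x + t • v), v⟫ t := by
  have hline : HasDerivAt (fun s : ℝ => x + s • v) v t := by
    simpa using ((hasDerivAt_id t).smul_const v).const_add x
  simpa [Function.comp_def] using
    (hdiff (x + t • v)).hasGradientAt.hasFDerivAt.comp_hasDerivAt t hline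

/-- A differentiable convex function lies above its tangent hyperplanes. -/
theorem add_inner_gradient_le_of_convexOn (hconv : ConvexOn ℝ Set.univ F)
    (hdiff : Differentiable ℝ F) (x y : E) :
    F x + ⟪gradient F x, y - x⟫ ≤ F y := by
  have hline : ConvexOn ℝ Set.univ (fun s : ℝ => F (x + s • (y - x))) := by
    have h := hconv.comp_affineMap (AffineMap.lineMap x y : ℝ →ᵃ[ℝ] E)
    simpa [Function.comp_def, AffineMap.lineMap_apply, add_comm] using h
  have h := hline.le_slope_of_hasDerivAt (Set.mem_univ 0) (Set.mem_univ 1) one_pos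
    (hasDerivAt_comp_add_smul_inner_gradient hdiff x (y - x) 0)
  simp only [slope_def_field, zero_smul, add_zero, one_smul, add_sub_cancel, sub_zero, div_one] at h
  linarith

/-- The descent lemma: a function with `L`-Lipschitz gradient lies below its quadratic upper
model. -/
theorem le_add_inner_gradient_add_sq {L : ℝ} (hdiff : Differentiable ℝ F)
    (hlip : ∀ x y : E, ‖gradient F x - gradient F y‖ ≤ L * ‖x - y‖) (x v : E) :
    F (x + v) ≤ F x + ⟪gradient F x, v⟫ + L / 2 * ‖v‖ ^ 2 := by
  have hF := hasDerivAt_comp_add_smul_inner_gradient hdiff x v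
  have hB (t : ℝ) : HasDerivAt
      (fun s : ℝ => F x + s * ⟪gradient F x, v⟫ + L / 2 * ‖v‖ ^ 2 * s ^ 2)
      (⟪gradient F x, v⟫ + L * ‖v‖ ^ 2 * t) t := by
    refine ((((hasDerivAt_id t).mul_const ⟪gradient F x, v⟫).const_add (F x)).add
      (((hasDerivAt_id t).pow 2).const_mul (L / 2 * ‖v‖ ^ 2))).congr_deriv ?_
    simp only [id_eq, Nat.cast_ofNat, Nat.add_one_sub_one, pow_one]
    ring
  have h := image_le_of_deriv_right_le_deriv_boundary (a := 0) (b := 1)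
    (fun t _ => (hF t).continuousAt.continuousWithinAt) (fun t _ => (hF t).hasDerivWithinAt)
    (by simp) (fun t _ => (hB t).continuousAt.continuousWithinAt)
    (fun t _ => (hB t).hasDerivWithinAt) (fun t ht => ?_) (Set.right_mem_Icc.2 zero_le_one)
  · simpa using h
  · have hg := hlip (x + t • v) x
    rw [add_sub_cancel_left, norm_smul, Real.norm_of_nonneg ht.1] at hg
    have hi := (real_inner_le_norm (gradient F (x + t • v) - gradient F x) v).trans
      (mul_le_mul_of_nonneg_right hg (norm_nonneg v))
    rw [inner_sub_left] at hi
    linarith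

end GradientBounds

/-- Lemma 2 of the appendix. -/
theorem descent_inequality_smooth
    (q : ℕ) (F : EuclideanSpace ℝ (Fin q) → ℝ) (L_F : ℝ) (hLF : 0 < L_F)
    (hconv : ConvexOn ℝ Set.univ F) (hdiff : Differentiable ℝ F)
    (hlip : ∀ x y : EuclideanSpace ℝ (Fin q),
      ‖gradient F x - gradient F y‖ ≤ L_F * ‖x - y‖)
    (d w xk xstar : EuclideanSpace ℝ (Fin q))
    (η : ℝ) (hη0 : 0 < η) (hη : η ≤ 1 / L_F)
    (μ xk1 : EuclideanSpace ℝ (Fin q))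
    (hμ : μ = d + w) (hxk1 : xk1 = xk - η • μ) :
    -(2 * η) * ⟪μ, xk - xstar⟫ + η ^ 2 * ‖μ‖ ^ 2
      ≤ -(2 * η) * (F xk1 - F xstar)
        - 2 * η * ⟪d - gradient F xk, xk1 - xstar⟫
        + 2 * η * ⟪w, xstar - xk1⟫ := by
  have hlower := add_inner_gradient_le_of_convexOn hconv hdiff xk xstar
  have hupper := le_add_inner_gradient_add_sq hdiff hlip xk (-(η • μ))
  rw [← sub_eq_add_neg, ← hxk1, norm_neg, norm_smul, Real.norm_of_nonneg hη0.le] at hupper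
  have hLη : η * L_F ≤ 1 := (le_div_iff₀ hLF).1 hη
  have hquad : L_F / 2 * (η * ‖μ‖) ^ 2 ≤ η / 2 * ‖μ‖ ^ 2 := by
    have := mul_le_mul_of_nonneg_right hLη (by positivity : 0 ≤ η / 2 * ‖μ‖ ^ 2)
    linarith
  have hgap : F xk1 - F xstar
      ≤ ⟪gradient F xk, xk - xstar⟫ - η * ⟪gradient F xk, μ⟫ + η / 2 * ‖μ‖ ^ 2 := by
    simp only [inner_sub_right, inner_neg_right, inner_smul_right] at hlower hupper ⊢
    linarith
  have hscaled := mul_le_mul_of_nonneg_left hgap (by positivity : 0 ≤ 2 * η)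
  have hnorm : ‖μ‖ ^ 2 = ⟪d, μ⟫ + ⟪w, μ⟫ := by
    rw [← real_inner_self_eq_norm_sq, ← inner_add_left, ← hμ]
  have hsplit (z : EuclideanSpace ℝ (Fin q)) : ⟪μ, z⟫ = ⟪d, z⟫ + ⟪w, z⟫ := by
    rw [hμ, inner_add_left]
  have hstep : xk1 - xstar = xk - xstar - η • μ := by rw [hxk1]; abel
  rw [← neg_sub xk1 xstar, hstep, hsplit]
  simp only [inner_sub_left, inner_neg_right, inner_sub_right, inner_smul_right] at hscaled ⊢
  linear_combination hscaled + 2 * η ^ 2 * hnorm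
end

section
/- Let n, m, N be positive natural numbers and C_G, L_f > 0. For j ∈ {1,…,m} let g_j : ℝ^q → ℝ^r be differentiable with ‖g_j(x) − g_j(y)‖ ≤ C_G·‖x − y‖ for all x, y, and with the operator norm of the Jacobian ∂g_j(x) bounded by C_G for all x. For i ∈ {1,…,n} let f_i : ℝ^r → ℝ be differentiable with ∇f_i being L_f-Lipschitz. Set g(x) := (1/m)·Σ_{j=1}^m g_j(x). Fix x, x̃, x_star ∈ ℝ^q, and for each tuple b = (b_1,…,b_N) ∈ {1,…,m}^N define ĝ_b := g(x̃) − (1/N)·Σ_{t=1}^N (g_{b_t}(x̃) − g_{b_t}(x)). Then (1/(n·m·m^N)) · Σ_{i=1}^n Σ_{j=1}^m Σ_{b ∈ {1,…,m}^N} ‖(∂g_j(x))ᵀ·(∇f_i(ĝ_b) − ∇f_i(g(x)))‖² ≤ (2·C_G⁴·L_f²/N)·(‖x − x_star‖² + ‖x̃ − x_star‖²). -/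
open scoped RealInnerProductSpace

section SamplingWithReplacement

variable {E : Type*} [NormedAddCommGroup E] [InnerProductSpace ℝ E]

/-- The second moment of a sum of `N` independent uniform samples from a centered finite family. -/
lemma card_mul_sum_norm_sq_sum_of_sum_eq_zero {m : ℕ} (e : Fin m → E) (he : ∑ j, e j = 0)
    (N : ℕ) :
    (m : ℝ) * ∑ b : Fin N → Fin m, ‖∑ t, e (b t)‖ ^ 2
      = N * (m : ℝ) ^ N * ∑ j, ‖e j‖ ^ 2 := by
  induction N with
  | zero => simp
  | succ N ih =>
    have hcross : ∑ j, ∑ b : Fin N → Fin m, 2 * ⟪e j, ∑ t, e (b t)⟫ = 0 := by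
      rw [Finset.sum_comm]
      refine Finset.sum_eq_zero fun b _ => ?_
      rw [← Finset.mul_sum, ← sum_inner, he, inner_zero_left, mul_zero]
    have hsplit : ∑ b : Fin (N + 1) → Fin m, ‖∑ t, e (b t)‖ ^ 2
        = (m : ℝ) ^ N * ∑ j, ‖e j‖ ^ 2
          + m * ∑ b : Fin N → Fin m, ‖∑ t, e (b t)‖ ^ 2 := by
      rw [← (Fin.consEquiv fun _ => Fin m).sum_comp, Fintype.sum_prod_type]
      simp only [Fin.consEquiv_apply, Fin.sum_univ_succ, Fin.cons_zero, Fin.cons_succ,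
        norm_add_sq_real, Finset.sum_add_distrib, hcross]
      simp [Finset.mul_sum]
    rw [hsplit, mul_add, ih]
    push_cast
    ring

/-- The sum of squared deviations from the mean is at most the sum of squared norms. -/
lemma sum_norm_sub_mean_sq_le {m : ℕ} (hm : 0 < m) (d : Fin m → E) (a : E)
    (ha : (m : ℝ) • a = ∑ j, d j) :
    ∑ j, ‖d j - a‖ ^ 2 ≤ ∑ j, ‖d j‖ ^ 2 := by
  have hinner : ∑ j, ⟪d j, a⟫ = m * ‖a‖ ^ 2 := by
    rw [← sum_inner, ← ha, real_inner_smul_left, real_inner_self_eq_norm_sq]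
  simp only [norm_sub_sq_real, Finset.sum_add_distrib, Finset.sum_sub_distrib, ← Finset.mul_sum,
    hinner, Finset.sum_const, Finset.card_univ, Fintype.card_fin, nsmul_eq_mul]
  have : 0 ≤ (m : ℝ) * ‖a‖ ^ 2 := by positivity
  linarith

/-- The variance of the mean of `N` independent uniform samples from a finite family is at most
`1 / N` times the second moment of that family. -/
lemma sum_norm_mean_sub_mean_sq_le {m N : ℕ} (hm : 0 < m) (hN : 0 < N) (d : Fin m → E) (a : E)
    (ha : (m : ℝ) • a = ∑ j, d j) {D : ℝ} (hD : ∀ j, ‖d j‖ ^ 2 ≤ D) :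
    ∑ b : Fin N → Fin m, ‖a - (1 / (N : ℝ)) • ∑ t, d (b t)‖ ^ 2 ≤ (m : ℝ) ^ N / N * D := by
  have hm' : (0 : ℝ) < m := by exact_mod_cast hm
  have hN' : (0 : ℝ) < N := by exact_mod_cast hN
  have hcenter : ∑ j, (d j - a) = 0 := by
    rw [Finset.sum_sub_distrib, ← ha]
    simp [← Nat.cast_smul_eq_nsmul ℝ]
  have hterm : ∀ b : Fin N → Fin m, ‖a - (1 / (N : ℝ)) • ∑ t, d (b t)‖ ^ 2
      = (1 / (N : ℝ)) ^ 2 * ‖∑ t, (d (b t) - a)‖ ^ 2 := by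
    intro b
    have hvec : a - (1 / (N : ℝ)) • ∑ t, d (b t)
        = -((1 / (N : ℝ)) • ∑ t, (d (b t) - a)) := by
      simp only [Finset.sum_sub_distrib, Finset.sum_const, Finset.card_univ, Fintype.card_fin,
        ← Nat.cast_smul_eq_nsmul ℝ, smul_sub, smul_smul, one_div, inv_mul_cancel₀ hN'.ne',
        one_smul, neg_sub]
    rw [hvec, norm_neg, norm_smul, mul_pow, Real.norm_of_nonneg (by positivity)]
  have hvar : ∑ j, ‖d j - a‖ ^ 2 ≤ m * D :=
    (sum_norm_sub_mean_sq_le hm d a ha).trans <|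
      (Finset.sum_le_sum fun j _ => hD j).trans_eq (by simp)
  have hmoment := card_mul_sum_norm_sq_sum_of_sum_eq_zero (fun j => d j - a) hcenter N
  have hsum : ∑ b : Fin N → Fin m, ‖∑ t, (d (b t) - a)‖ ^ 2 ≤ N * (m : ℝ) ^ N * D := by
    refine le_of_mul_le_mul_left ?_ hm'
    calc _ = _ := hmoment
      _ ≤ N * (m : ℝ) ^ N * (m * D) := by gcongr
      _ = _ := by ring
  simp only [hterm, ← Finset.mul_sum]
  calc _ ≤ (1 / (N : ℝ)) ^ 2 * (N * (m : ℝ) ^ N * D) := by gcongr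
    _ = _ := by field_simp

end SamplingWithReplacement

/-- The squared norm of a difference is controlled through any third point. -/
lemma norm_sub_sq_le_two_mul_add {E : Type*} [SeminormedAddCommGroup E] (x y z : E) :
    ‖y - x‖ ^ 2 ≤ 2 * (‖x - z‖ ^ 2 + ‖y - z‖ ^ 2) := by
  have h : ‖y - x‖ ≤ ‖y - z‖ + ‖x - z‖ := by
    simpa using norm_sub_le (y - z) (x - z)
  nlinarith [norm_nonneg (y - x), sq_nonneg (‖y - z‖ - ‖x - z‖)]

/-- bound on the term `T₄` in the proof of Lemma 3 of the appendix. -/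
theorem inner_estimate_variance_bound
    (q r n m N : ℕ) (hn : 0 < n) (hm : 0 < m) (hN : 0 < N)
    (C_G L_f : ℝ) (hCG : 0 < C_G) (hLf : 0 < L_f)
    (g : Fin m → EuclideanSpace ℝ (Fin q) → EuclideanSpace ℝ (Fin r))
    (hgdiff : ∀ j, Differentiable ℝ (g j))
    (hglip : ∀ (j : Fin m) (x y : EuclideanSpace ℝ (Fin q)),
      ‖g j x - g j y‖ ≤ C_G * ‖x - y‖)
    (hgjac : ∀ (j : Fin m) (x : EuclideanSpace ℝ (Fin q)), ‖fderiv ℝ (g j) x‖ ≤ C_G)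
    (f : Fin n → EuclideanSpace ℝ (Fin r) → ℝ)
    (hfdiff : ∀ i, Differentiable ℝ (f i))
    (hflip : ∀ (i : Fin n) (u v : EuclideanSpace ℝ (Fin r)),
      ‖gradient (f i) u - gradient (f i) v‖ ≤ L_f * ‖u - v‖)
    (x xtil xstar : EuclideanSpace ℝ (Fin q))
    (gbar : EuclideanSpace ℝ (Fin q) → EuclideanSpace ℝ (Fin r))
    (hgbar : ∀ z, gbar z = (1 / (m : ℝ)) • ∑ j : Fin m, g j z)
    (ghat : (Fin N → Fin m) → EuclideanSpace ℝ (Fin r))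
    (hghat : ∀ b : Fin N → Fin m,
      ghat b = gbar xtil - (1 / (N : ℝ)) • ∑ t : Fin N, (g (b t) xtil - g (b t) x)) :
    (1 / ((n : ℝ) * (m : ℝ) * (m : ℝ) ^ N)) *
        ∑ i : Fin n, ∑ j : Fin m, ∑ b : Fin N → Fin m,
          ‖ContinuousLinearMap.adjoint (fderiv ℝ (g j) x)
              (gradient (f i) (ghat b) - gradient (f i) (gbar x))‖ ^ 2
      ≤ (2 * C_G ^ 4 * L_f ^ 2 / (N : ℝ)) *
          (‖x - xstar‖ ^ 2 + ‖xtil - xstar‖ ^ 2) := by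
  have hm' : (0 : ℝ) < m := by exact_mod_cast hm
  have hn' : (0 : ℝ) < n := by exact_mod_cast hn
  have hN' : (0 : ℝ) < N := by exact_mod_cast hN
  have hterm : ∀ (i : Fin n) (j : Fin m) (b : Fin N → Fin m),
      ‖ContinuousLinearMap.adjoint (fderiv ℝ (g j) x)
          (gradient (f i) (ghat b) - gradient (f i) (gbar x))‖ ^ 2
        ≤ (C_G * L_f) ^ 2 * ‖ghat b - gbar x‖ ^ 2 := by
    intro i j b
    rw [← mul_pow, mul_assoc]
    gcongr
    refine (ContinuousLinearMap.le_opNorm _ _).trans ?_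
    rw [LinearIsometryEquiv.norm_map]
    gcongr
    exacts [hgjac j x, hflip i _ _]
  have hmean : (m : ℝ) • (gbar xtil - gbar x) = ∑ j, (g j xtil - g j x) := by
    rw [hgbar, hgbar, ← smul_sub, smul_smul, mul_one_div_cancel hm'.ne', one_smul,
      Finset.sum_sub_distrib]
  have hdiff : ∀ j, ‖g j xtil - g j x‖ ^ 2
      ≤ C_G ^ 2 * (2 * (‖x - xstar‖ ^ 2 + ‖xtil - xstar‖ ^ 2)) := by
    intro j
    calc _ ≤ (C_G * ‖xtil - x‖) ^ 2 := by gcongr; exact hglip j _ _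
      _ = C_G ^ 2 * ‖xtil - x‖ ^ 2 := mul_pow _ _ _
      _ ≤ _ := by gcongr; exact norm_sub_sq_le_two_mul_add _ _ _
  have hvar : ∑ b, ‖ghat b - gbar x‖ ^ 2
      ≤ (m : ℝ) ^ N / N * (C_G ^ 2 * (2 * (‖x - xstar‖ ^ 2 + ‖xtil - xstar‖ ^ 2))) := by
    simp only [hghat, sub_right_comm (gbar xtil) _ (gbar x)]
    exact sum_norm_mean_sub_mean_sq_le hm hN (fun j => g j xtil - g j x) _ hmean hdiff
  calc _ ≤ (1 / ((n : ℝ) * m * (m : ℝ) ^ N)) *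
        ∑ _i : Fin n, ∑ _j : Fin m, ∑ b, (C_G * L_f) ^ 2 * ‖ghat b - gbar x‖ ^ 2 := by
        gcongr with i _ j _ b _
        exact hterm i j b
    _ = (1 / (m : ℝ) ^ N) * ((C_G * L_f) ^ 2 * ∑ b, ‖ghat b - gbar x‖ ^ 2) := by
        simp only [← Finset.mul_sum, Finset.sum_const, Finset.card_univ, Fintype.card_fin,
          nsmul_eq_mul]
        field_simp
    _ ≤ (1 / (m : ℝ) ^ N) * ((C_G * L_f) ^ 2 * ((m : ℝ) ^ N / N *
          (C_G ^ 2 * (2 * (‖x - xstar‖ ^ 2 + ‖xtil - xstar‖ ^ 2))))) := by gcongr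
    _ = _ := by field_simp
end

section
/- Let n, m, N be positive natural numbers and C_G, L_f, L_F > 0. For j ∈ {1,…,m} let g_j : ℝ^q → ℝ^r be differentiable with ‖g_j(x) − g_j(y)‖ ≤ C_G·‖x − y‖ for all x, y and with the operator norm of the Jacobian ∂g_j(x) bounded by C_G for all x. For i ∈ {1,…,n} let f_i : ℝ^r → ℝ be differentiable with ∇f_i being L_f-Lipschitz. Set g(x) := (1/m)·Σ_{j=1}^m g_j(x), and assume each map h_{ij}(x) := (∂g_j(x))ᵀ·∇f_i(g(x)) is L_F-Lipschitz. Define Φ(x) := (1/(n·m))·Σ_{i=1}^n Σ_{j=1}^m h_{ij}(x). Fix x, x̃, x_star ∈ ℝ^q; for each tuple b ∈ {1,…,m}^N define ĝ_b := g(x̃) − (1/N)·Σ_{t=1}^N (g_{b_t}(x̃) − g_{b_t}(x)), and for each (i, j, b) define the estimator v_{i,j,b} := (∂g_j(x))ᵀ·∇f_i(ĝ_b) − (∂g_j(x̃))ᵀ·∇f_i(g(x̃)) + Φ(x̃). Then (1/(n·m·m^N)) · Σ_{i,j,b} ‖v_{i,j,b} − Φ(x)‖² ≤ (8·C_G⁴·L_f²/N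 + 12·L_F²)·(‖x − x_star‖² + ‖x̃ − x_star‖²). -/
open scoped RealInnerProductSpace

theorem norm_add_sq_le_two_mul {E : Type*} [SeminormedAddCommGroup E] (a b : E) :
    ‖a + b‖ ^ 2 ≤ 2 * ‖a‖ ^ 2 + 2 * ‖b‖ ^ 2 := by
  nlinarith [norm_add_le a b, norm_nonneg (a + b), sq_nonneg (‖a‖ - ‖b‖), norm_nonneg a,
    norm_nonneg b]

section Averages

variable {ι E : Type*} [Fintype ι] [NormedAddCommGroup E] [InnerProductSpace ℝ E]

/-- Subtracting the mean does not increase the sum of squared norms. -/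
theorem sum_norm_sub_mean_sq_le_s6 (a : ι → E) (μ : E) (hμ : (Fintype.card ι : ℝ) • μ = ∑ i, a i) :
    ∑ i, ‖a i - μ‖ ^ 2 ≤ ∑ i, ‖a i‖ ^ 2 := by
  have key : ∑ i, ‖a i - μ‖ ^ 2 = ∑ i, ‖a i‖ ^ 2 - (Fintype.card ι : ℝ) * ‖μ‖ ^ 2 := by
    simp only [norm_sub_sq_real, Finset.sum_add_distrib, Finset.sum_sub_distrib,
      ← Finset.mul_sum, ← sum_inner, ← hμ, real_inner_smul_left, real_inner_self_eq_norm_sq,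
      Finset.sum_const, Finset.card_univ, nsmul_eq_mul]
    ring
  rw [key]
  exact sub_le_self _ (by positivity)

/-- Second moment of a sum of `N` independent uniform samples from a centred finite family. -/
theorem card_mul_sum_norm_sum_sq (e : ι → E) (he : ∑ i, e i = 0) (N : ℕ) :
    (Fintype.card ι : ℝ) * ∑ b : Fin N → ι, ‖∑ t, e (b t)‖ ^ 2 =
      N * (Fintype.card ι : ℝ) ^ N * ∑ i, ‖e i‖ ^ 2 := by
  induction N with
  | zero => simp
  | succ N ih =>
    have split : ∑ b : Fin (N + 1) → ι, ‖∑ t, e (b t)‖ ^ 2 =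
        ∑ b : Fin N → ι, ∑ i, ‖e i + ∑ t, e (b t)‖ ^ 2 := by
      rw [← (Fin.consEquiv (fun _ => ι)).sum_comp, Fintype.sum_prod_type_right]
      simp [Fin.consEquiv, Fin.sum_univ_succ]
    have expand : ∀ s : E, ∑ i, ‖e i + s‖ ^ 2 =
        ∑ i, ‖e i‖ ^ 2 + (Fintype.card ι : ℝ) * ‖s‖ ^ 2 := by
      intro s
      simp [norm_add_sq_real, Finset.sum_add_distrib, ← Finset.mul_sum, ← sum_inner, he]
    simp only [split, expand, Finset.sum_add_distrib, ← Finset.mul_sum, ih]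
    simp only [Finset.sum_const, Finset.card_univ, Fintype.card_pi, Finset.prod_const,
      Fintype.card_fin, nsmul_eq_mul]
    push_cast
    ring

end Averages

/-- bound on the term `T₂` in the proof of Lemma 3 of the appendix:
mean-squared error of the SVRG-type gradient estimator of com-SVR-ADMM. -/
theorem svrg_gradient_estimator_mse_bound
    (q r n m N : ℕ) (hn : 0 < n) (hm : 0 < m) (hN : 0 < N)
    (C_G L_f L_F : ℝ) (hCG : 0 < C_G) (hLf : 0 < L_f) (hLF : 0 < L_F)
    (g : Fin m → EuclideanSpace ℝ (Fin q) → EuclideanSpace ℝ (Fin r))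
    (hgdiff : ∀ j, Differentiable ℝ (g j))
    (hglip : ∀ (j : Fin m) (x y : EuclideanSpace ℝ (Fin q)),
      ‖g j x - g j y‖ ≤ C_G * ‖x - y‖)
    (hgjac : ∀ (j : Fin m) (x : EuclideanSpace ℝ (Fin q)), ‖fderiv ℝ (g j) x‖ ≤ C_G)
    (f : Fin n → EuclideanSpace ℝ (Fin r) → ℝ)
    (hfdiff : ∀ i, Differentiable ℝ (f i))
    (hflip : ∀ (i : Fin n) (u v : EuclideanSpace ℝ (Fin r)),
      ‖gradient (f i) u - gradient (f i) v‖ ≤ L_f * ‖u - v‖)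
    (gbar : EuclideanSpace ℝ (Fin q) → EuclideanSpace ℝ (Fin r))
    (hgbar : ∀ z, gbar z = (1 / (m : ℝ)) • ∑ j : Fin m, g j z)
    (h : Fin n → Fin m → EuclideanSpace ℝ (Fin q) → EuclideanSpace ℝ (Fin q))
    (hh : ∀ (i : Fin n) (j : Fin m) (z : EuclideanSpace ℝ (Fin q)),
      h i j z = ContinuousLinearMap.adjoint (fderiv ℝ (g j) z) (gradient (f i) (gbar z)))
    (hhlip : ∀ (i : Fin n) (j : Fin m) (x y : EuclideanSpace ℝ (Fin q)),
      ‖h i j x - h i j y‖ ≤ L_F * ‖x - y‖)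
    (Φ : EuclideanSpace ℝ (Fin q) → EuclideanSpace ℝ (Fin q))
    (hΦ : ∀ z, Φ z = (1 / ((n : ℝ) * (m : ℝ))) • ∑ i : Fin n, ∑ j : Fin m, h i j z)
    (x xtil xstar : EuclideanSpace ℝ (Fin q))
    (ghat : (Fin N → Fin m) → EuclideanSpace ℝ (Fin r))
    (hghat : ∀ b : Fin N → Fin m,
      ghat b = gbar xtil - (1 / (N : ℝ)) • ∑ t : Fin N, (g (b t) xtil - g (b t) x))
    (v : Fin n → Fin m → (Fin N → Fin m) → EuclideanSpace ℝ (Fin q))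
    (hv : ∀ (i : Fin n) (j : Fin m) (b : Fin N → Fin m),
      v i j b = ContinuousLinearMap.adjoint (fderiv ℝ (g j) x) (gradient (f i) (ghat b))
        - ContinuousLinearMap.adjoint (fderiv ℝ (g j) xtil) (gradient (f i) (gbar xtil))
        + Φ xtil) :
    (1 / ((n : ℝ) * (m : ℝ) * (m : ℝ) ^ N)) *
        ∑ i : Fin n, ∑ j : Fin m, ∑ b : Fin N → Fin m, ‖v i j b - Φ x‖ ^ 2
      ≤ (8 * C_G ^ 4 * L_f ^ 2 / (N : ℝ) + 12 * L_F ^ 2) *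
          (‖x - xstar‖ ^ 2 + ‖xtil - xstar‖ ^ 2) := by
  have hn' : (0 : ℝ) < n := by exact_mod_cast hn
  have hm' : (0 : ℝ) < m := by exact_mod_cast hm
  have hN' : (0 : ℝ) < N := by exact_mod_cast hN
  set D := ‖x - xtil‖ with hD
  have hD2 : D ^ 2 ≤ 2 * (‖x - xstar‖ ^ 2 + ‖xtil - xstar‖ ^ 2) := by
    have := norm_add_sq_le_two_mul (x - xstar) (-(xtil - xstar))
    rw [norm_neg, show x - xstar + -(xtil - xstar) = x - xtil by abel] at this
    linarith
  -- sampling error of the inner mini-batch estimate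
  have hinner : ∑ b, ‖ghat b - gbar x‖ ^ 2 ≤ (m : ℝ) ^ N * (C_G ^ 2 * D ^ 2 / N) := by
    set d : Fin m → EuclideanSpace ℝ (Fin r) := fun j => g j xtil - g j x with hd
    set μ := gbar xtil - gbar x with hμ
    have hmean : (m : ℝ) • μ = ∑ j, d j := by
      simp only [hμ, hd, hgbar, ← smul_sub, smul_smul, Finset.sum_sub_distrib]
      rw [mul_one_div_cancel hm'.ne', one_smul]
    have hcent : ∑ j, (d j - μ) = 0 := by
      rw [Finset.sum_sub_distrib, ← hmean]
      simp [← Nat.cast_smul_eq_nsmul ℝ]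
    have herr : ∀ b, ‖ghat b - gbar x‖ ^ 2 =
        (1 / (N : ℝ)) ^ 2 * ‖∑ t, (d (b t) - μ)‖ ^ 2 := by
      intro b
      have : ghat b - gbar x = -((1 / (N : ℝ)) • ∑ t, (d (b t) - μ)) := by
        rw [Finset.sum_sub_distrib, smul_sub, hghat]
        simp only [Finset.sum_const, Finset.card_univ, Fintype.card_fin,
          ← Nat.cast_smul_eq_nsmul ℝ, smul_smul, one_div_mul_cancel hN'.ne', one_smul, hμ, hd]
        abel
      rw [this, norm_neg, norm_smul, mul_pow, Real.norm_eq_abs, sq_abs]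
    have hmom := card_mul_sum_norm_sum_sq (fun j => d j - μ) hcent N
    have hvar := sum_norm_sub_mean_sq_le_s6 d μ (by simpa using hmean)
    have hbd : ∑ j, ‖d j‖ ^ 2 ≤ m * (C_G ^ 2 * D ^ 2) := by
      have : ∀ j ∈ Finset.univ, ‖d j‖ ^ 2 ≤ C_G ^ 2 * D ^ 2 := by
        intro j _
        rw [← mul_pow, hD, norm_sub_rev x]
        exact pow_le_pow_left₀ (norm_nonneg _) (hglip j xtil x) 2
      simpa using Finset.sum_le_sum this
    simp only [herr, ← Finset.mul_sum]
    rw [Fintype.card_fin] at hmom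
    have hsum : ∑ b : Fin N → Fin m, ‖∑ t, (d (b t) - μ)‖ ^ 2 ≤
        N * (m : ℝ) ^ N * (C_G ^ 2 * D ^ 2) := by
      refine le_of_mul_le_mul_left ?_ hm'
      rw [hmom]
      calc (N : ℝ) * (m : ℝ) ^ N * ∑ j, ‖d j - μ‖ ^ 2
          ≤ N * (m : ℝ) ^ N * (m * (C_G ^ 2 * D ^ 2)) := by
            gcongr
            exact hvar.trans hbd
        _ = _ := by ring
    calc (1 / (N : ℝ)) ^ 2 * ∑ b : Fin N → Fin m, ‖∑ t, (d (b t) - μ)‖ ^ 2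
        ≤ (1 / (N : ℝ)) ^ 2 * (N * (m : ℝ) ^ N * (C_G ^ 2 * D ^ 2)) := by gcongr
      _ = _ := by field_simp
  -- variance of the outer estimate
  have houter : ∑ i, ∑ j, ‖(h i j x - h i j xtil) - (Φ x - Φ xtil)‖ ^ 2 ≤
      n * m * (L_F ^ 2 * D ^ 2) := by
    have hvar := sum_norm_sub_mean_sq_le_s6
      (fun p : Fin n × Fin m => h p.1 p.2 x - h p.1 p.2 xtil) (Φ x - Φ xtil) (by
        simp only [hΦ, ← smul_sub, smul_smul, Fintype.card_prod, Fintype.card_fin, Nat.cast_mul,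
          Fintype.sum_prod_type, Finset.sum_sub_distrib]
        rw [mul_one_div_cancel (by positivity), one_smul])
    have hbd : ∀ p ∈ (Finset.univ : Finset (Fin n × Fin m)),
        ‖h p.1 p.2 x - h p.1 p.2 xtil‖ ^ 2 ≤ L_F ^ 2 * D ^ 2 := by
      intro p _
      rw [← mul_pow]
      exact pow_le_pow_left₀ (norm_nonneg _) (hhlip p.1 p.2 x xtil) 2
    rw [← Fintype.sum_prod_type' (f := fun i j =>
      ‖(h i j x - h i j xtil) - (Φ x - Φ xtil)‖ ^ 2)]
    refine hvar.trans ((Finset.sum_le_sum hbd).trans_eq ?_)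
    simp
  have hpoint : ∀ i j b, ‖v i j b - Φ x‖ ^ 2 ≤
      2 * (C_G ^ 2 * L_f ^ 2 * ‖ghat b - gbar x‖ ^ 2) +
        2 * ‖(h i j x - h i j xtil) - (Φ x - Φ xtil)‖ ^ 2 := by
    intro i j b
    have hdec : v i j b - Φ x =
        ContinuousLinearMap.adjoint (fderiv ℝ (g j) x)
          (gradient (f i) (ghat b) - gradient (f i) (gbar x)) +
        ((h i j x - h i j xtil) - (Φ x - Φ xtil)) := by
      rw [hv, hh, hh, map_sub]
      abel
    have hA : ‖ContinuousLinearMap.adjoint (fderiv ℝ (g j) x)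
        (gradient (f i) (ghat b) - gradient (f i) (gbar x))‖ ≤
          C_G * (L_f * ‖ghat b - gbar x‖) := by
      refine (ContinuousLinearMap.le_opNorm _ _).trans ?_
      rw [LinearIsometryEquiv.norm_map]
      exact mul_le_mul (hgjac j x) (hflip i _ _) (norm_nonneg _) hCG.le
    have hA2 := pow_le_pow_left₀ (norm_nonneg _) hA 2
    rw [hdec]
    refine (norm_add_sq_le_two_mul _ _).trans ?_
    rw [mul_pow, mul_pow, ← mul_assoc] at hA2
    linarith
  have htotal : ∑ i, ∑ j, ∑ b, ‖v i j b - Φ x‖ ^ 2 ≤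
      n * m * (m : ℝ) ^ N * ((2 * C_G ^ 4 * L_f ^ 2 / N + 2 * L_F ^ 2) * D ^ 2) := by
    calc ∑ i, ∑ j, ∑ b, ‖v i j b - Φ x‖ ^ 2
        ≤ ∑ i, ∑ j, ∑ b, (2 * (C_G ^ 2 * L_f ^ 2 * ‖ghat b - gbar x‖ ^ 2) +
            2 * ‖(h i j x - h i j xtil) - (Φ x - Φ xtil)‖ ^ 2) := by
          gcongr with i _ j _ b _
          exact hpoint i j b
      _ = n * m * (2 * (C_G ^ 2 * L_f ^ 2 * ∑ b, ‖ghat b - gbar x‖ ^ 2)) +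
            (m : ℝ) ^ N * (2 *
              ∑ i, ∑ j, ‖(h i j x - h i j xtil) - (Φ x - Φ xtil)‖ ^ 2) := by
          simp only [Finset.sum_add_distrib, ← Finset.mul_sum, Finset.sum_const,
            Finset.card_univ, Fintype.card_fin, Fintype.card_pi, Finset.prod_const,
            nsmul_eq_mul, Nat.cast_pow]
          ring
      _ ≤ n * m * (2 * (C_G ^ 2 * L_f ^ 2 * ((m : ℝ) ^ N * (C_G ^ 2 * D ^ 2 / N)))) +
            (m : ℝ) ^ N * (2 * (n * m * (L_F ^ 2 * D ^ 2))) := by gcongr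
      _ = _ := by ring
  have hS : 0 ≤ ‖x - xstar‖ ^ 2 + ‖xtil - xstar‖ ^ 2 := by positivity
  calc (1 / ((n : ℝ) * (m : ℝ) * (m : ℝ) ^ N)) * ∑ i, ∑ j, ∑ b, ‖v i j b - Φ x‖ ^ 2
      ≤ (2 * C_G ^ 4 * L_f ^ 2 / N + 2 * L_F ^ 2) * D ^ 2 := by
        rw [one_div, inv_mul_le_iff₀ (by positivity)]
        exact htotal
    _ ≤ (2 * C_G ^ 4 * L_f ^ 2 / N + 2 * L_F ^ 2) *
          (2 * (‖x - xstar‖ ^ 2 + ‖xtil - xstar‖ ^ 2)) := by gcongr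
    _ = (4 * C_G ^ 4 * L_f ^ 2 / N + 4 * L_F ^ 2) *
          (‖x - xstar‖ ^ 2 + ‖xtil - xstar‖ ^ 2) := by ring
    _ ≤ _ := by
        gcongr <;> norm_num
end

section
/- Let A be a p×q real matrix, B a p×l real matrix, ρ > 0, and let x_k, x_{k+1} ∈ ℝ^q, ω_{k+1}, ω_star ∈ ℝ^l, λ_k, λ_star ∈ ℝ^p. Let R : ℝ^l → ℝ and suppose: (i) the vector v⁺ := −Bᵀλ_k − ρ·Bᵀ(A·x_k + B·ω_{k+1}) is a subgradient of R at ω_{k+1}, i.e. R(ω) ≥ R(ω_{k+1}) + ⟨v⁺, ω − ω_{k+1}⟩ for all ω; (ii) the vector v_star := −Bᵀλ_star is a subgradient of R at ω_star, i.e. R(ω) ≥ R(ω_star) + ⟨v_star, ω − ω_star⟩ for all ω. Define λ_{k+1} := λ_k + ρ·(A·x_{k+1} + B·ω_{k+1}). Then R(ω_{k+1}) − R(ω_star) − ⟨v_star, ω_{k+1} − ω_star⟩ + ⟨λ_{k+1} − λ_star, B·ω_{k+1} − B·ω_star⟩ ≤ (ρ/2)·(‖A·x_k + B·ω_star‖²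 − ‖A·x_{k+1} + B·ω_star‖² + ‖A·x_{k+1} + B·ω_{k+1}‖²). -/
open scoped RealInnerProductSpace
open Matrix

theorem inner_toEuclideanLin_transpose {p l : ℕ} (B : Matrix (Fin p) (Fin l) ℝ)
    (y : EuclideanSpace ℝ (Fin p)) (w : EuclideanSpace ℝ (Fin l)) :
    ⟪Matrix.toEuclideanLin Bᵀ y, w⟫ = ⟪y, Matrix.toEuclideanLin B w⟫ := by
  rw [← Matrix.conjTranspose_eq_transpose_of_trivial,
    Matrix.toEuclideanLin_conjTranspose_eq_adjoint, LinearMap.adjoint_inner_left]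

/-- The four-point identity for inner products. -/
theorem two_mul_inner_sub_sub {E : Type*} [NormedAddCommGroup E] [InnerProductSpace ℝ E]
    (a a' b c : E) :
    2 * ⟪a' - a, b - c⟫ = ‖a' + b‖ ^ 2 - ‖a' + c‖ ^ 2 - ‖a + b‖ ^ 2 + ‖a + c‖ ^ 2 := by
  simp only [norm_add_sq_real, inner_sub_left, inner_sub_right]
  ring

/-- Lemma 4 of the appendix, stated deterministically. -/
theorem admm_regularizer_descent
    (p q l : ℕ) (A : Matrix (Fin p) (Fin q) ℝ) (B : Matrix (Fin p) (Fin l) ℝ)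
    (ρ : ℝ) (hρ : 0 < ρ)
    (xk xk1 : EuclideanSpace ℝ (Fin q))
    (ωk1 ωstar : EuclideanSpace ℝ (Fin l))
    (lamk lamstar lamk1 : EuclideanSpace ℝ (Fin p))
    (R : EuclideanSpace ℝ (Fin l) → ℝ)
    (vplus vstar : EuclideanSpace ℝ (Fin l))
    (hvplus : vplus = -(Matrix.toEuclideanLin Bᵀ lamk) -
      ρ • Matrix.toEuclideanLin Bᵀ (Matrix.toEuclideanLin A xk + Matrix.toEuclideanLin B ωk1))
    (hsubplus : ∀ ω : EuclideanSpace ℝ (Fin l), R ω ≥ R ωk1 + ⟪vplus, ω - ωk1⟫)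
    (hvstar : vstar = -(Matrix.toEuclideanLin Bᵀ lamstar))
    (hsubstar : ∀ ω : EuclideanSpace ℝ (Fin l), R ω ≥ R ωstar + ⟪vstar, ω - ωstar⟫)
    (hlam : lamk1 = lamk + ρ • (Matrix.toEuclideanLin A xk1 + Matrix.toEuclideanLin B ωk1)) :
    R ωk1 - R ωstar - ⟪vstar, ωk1 - ωstar⟫ +
        ⟪lamk1 - lamstar, Matrix.toEuclideanLin B ωk1 - Matrix.toEuclideanLin B ωstar⟫
      ≤ (ρ / 2) *
          (‖Matrix.toEuclideanLin A xk + Matrix.toEuclideanLin B ωstar‖ ^ 2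
            - ‖Matrix.toEuclideanLin A xk1 + Matrix.toEuclideanLin B ωstar‖ ^ 2
            + ‖Matrix.toEuclideanLin A xk1 + Matrix.toEuclideanLin B ωk1‖ ^ 2) := by
  have hsub := hsubplus ωstar
  rw [← neg_sub ωk1 ωstar, inner_neg_right] at hsub
  have hplus : ⟪vplus, ωk1 - ωstar⟫ = -⟪lamk + ρ • (toEuclideanLin A xk + toEuclideanLin B ωk1),
      toEuclideanLin B ωk1 - toEuclideanLin B ωstar⟫ := by
    rw [hvplus, ← LinearMap.map_smul, sub_eq_add_neg, ← neg_add, ← LinearMap.map_add,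
      inner_neg_left, inner_toEuclideanLin_transpose, map_sub]
  have hstar : ⟪vstar, ωk1 - ωstar⟫ =
      -⟪lamstar, toEuclideanLin B ωk1 - toEuclideanLin B ωstar⟫ := by
    rw [hvstar, inner_neg_left, inner_toEuclideanLin_transpose, map_sub]
  have hid := two_mul_inner_sub_sub (toEuclideanLin A xk) (toEuclideanLin A xk1)
    (toEuclideanLin B ωk1) (toEuclideanLin B ωstar)
  have hnonneg : 0 ≤ ρ * ‖toEuclideanLin A xk + toEuclideanLin B ωk1‖ ^ 2 := by positivity
  rw [hplus] at hsub
  rw [hstar, hlam]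
  simp only [inner_sub_left _ _ (_ - _), inner_add_left _ _ (_ - _),
    real_inner_smul_left] at hsub hid ⊢
  linear_combination hsub + (1 / 2) * hnonneg + (ρ / 2) * hid
end

section
/- Let F : ℝ^q → ℝ be convex and differentiable with ∇F being L_F-Lipschitz, where L_F > 0, and let η > 0. Let G be a symmetric positive definite q×q real matrix such that G − (L_F·η)·I is positive semidefinite (equivalently, L_F·η·G⁻¹ ⪯ I). Let d, w, x_k, x_star ∈ ℝ^q, set μ := d + w and x_{k+1} := x_k − η·G⁻¹·μ. Then −2η·⟨μ, x_k − x_star⟩ + η²·⟨μ, G⁻¹·μ⟩ ≤ −2η·(F(x_{k+1}) − F(x_star)) − 2η·⟨d − ∇F(x_k), x_{k+1} − x_star⟩ + 2η·⟨w, x_star − x_{k+1}⟩. -/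
open scoped RealInnerProductSpace
open Matrix

section Gradient

variable {E : Type*} [NormedAddCommGroup E] [InnerProductSpace ℝ E] [CompleteSpace E]

/-- The derivative of a differentiable function along a line, in terms of its gradient. -/
theorem hasDerivAt_comp_lineMap_gradient {f : E → ℝ} (hf : Differentiable ℝ f) (x y : E) (t : ℝ) :
    HasDerivAt (f ∘ AffineMap.lineMap x y)
      ⟪gradient f (AffineMap.lineMap x y t), y - x⟫ t := by
  have h := (hf (AffineMap.lineMap x y t)).hasGradientAt.hasFDerivAt.comp_hasDerivAt t
    (AffineMap.hasDerivAt_lineMap (a := x) (b := y) (x := t))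
  simpa using h

/-- First-order lower bound for a differentiable convex function. -/
theorem ConvexOn.add_inner_gradient_le {f : E → ℝ} (hconv : ConvexOn ℝ Set.univ f)
    (hf : Differentiable ℝ f) (x y : E) : f x + ⟪gradient f x, y - x⟫ ≤ f y := by
  have hc : ConvexOn ℝ Set.univ (f ∘ (AffineMap.lineMap x y : ℝ →ᵃ[ℝ] E)) := by
    simpa using hconv.comp_affineMap (AffineMap.lineMap x y)
  have h := hc.le_slope_of_hasDerivAt (Set.mem_univ 0) (Set.mem_univ 1) one_pos
    (hasDerivAt_comp_lineMap_gradient hf x y 0)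
  simp only [slope_def_field, Function.comp_apply, AffineMap.lineMap_apply_zero,
    AffineMap.lineMap_apply_one, sub_zero, div_one] at h
  linarith

/-- Descent lemma: quadratic upper bound for a function with Lipschitz gradient. -/
theorem le_add_inner_gradient_add_of_lipschitz_gradient {f : E → ℝ} {L : ℝ}
    (hf : Differentiable ℝ f) (hlip : ∀ x y, ‖gradient f x - gradient f y‖ ≤ L * ‖x - y‖)
    (x y : E) : f y ≤ f x + ⟪gradient f x, y - x⟫ + L / 2 * ‖y - x‖ ^ 2 := by
  set φ : ℝ → ℝ := fun t ↦ (f ∘ AffineMap.lineMap x y) t - t * ⟪gradient f x, y - x⟫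
    - t ^ 2 * (L / 2 * ‖y - x‖ ^ 2) with hφ
  have hd (t : ℝ) : HasDerivAt φ (⟪gradient f (AffineMap.lineMap x y t), y - x⟫
      - 1 * ⟪gradient f x, y - x⟫ - (2 * t) * (L / 2 * ‖y - x‖ ^ 2)) t := by
    have h2 : HasDerivAt (fun t : ℝ ↦ t ^ 2) (2 * t) t := by simpa using hasDerivAt_pow 2 t
    exact ((hasDerivAt_comp_lineMap_gradient hf x y t).sub
      ((hasDerivAt_id t).mul_const _)).sub (h2.mul_const _)
  have hanti : AntitoneOn φ (Set.Icc 0 1) := by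
    refine antitoneOn_of_deriv_nonpos (convex_Icc 0 1)
      (fun t _ ↦ (hd t).continuousAt.continuousWithinAt)
      (fun t _ ↦ (hd t).differentiableAt.differentiableWithinAt) fun t ht ↦ ?_
    rw [interior_Icc] at ht
    rw [(hd t).deriv, one_mul, ← inner_sub_left]
    have h := hlip (AffineMap.lineMap x y t) x
    have hn : ‖AffineMap.lineMap x y t - x‖ = t * ‖y - x‖ := by
      rw [AffineMap.lineMap_apply_module', add_sub_cancel_right, norm_smul, Real.norm_eq_abs,
        abs_of_pos ht.1]
    rw [hn] at h
    have := (real_inner_le_norm _ _).trans (mul_le_mul_of_nonneg_right h (norm_nonneg (y - x)))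
    linarith
  have h := hanti (Set.left_mem_Icc.2 zero_le_one) (Set.right_mem_Icc.2 zero_le_one) zero_le_one
  simp only [hφ, Function.comp_apply, AffineMap.lineMap_apply_zero,
    AffineMap.lineMap_apply_one] at h
  linarith

end Gradient

/-- If `c • 1 ≤ G` in the Loewner order, then `c * ‖G⁻¹ v‖ ^ 2 ≤ ⟪v, G⁻¹ v⟫`. -/
theorem Matrix.PosDef.mul_norm_sq_inv_le_inner {n : Type*} [Fintype n] [DecidableEq n]
    {G : Matrix n n ℝ} (hG : G.PosDef) {c : ℝ} (hc : (G - c • (1 : Matrix n n ℝ)).PosSemidef)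
    (v : EuclideanSpace ℝ n) :
    c * ‖Matrix.toEuclideanLin G⁻¹ v‖ ^ 2 ≤ ⟪v, Matrix.toEuclideanLin G⁻¹ v⟫ := by
  have h := hc.dotProduct_mulVec_nonneg (G⁻¹ *ᵥ v.ofLp)
  rw [Matrix.sub_mulVec, Matrix.mulVec_mulVec,
    Matrix.mul_nonsing_inv _ ((Matrix.isUnit_iff_isUnit_det _).1 hG.isUnit)] at h
  simp only [Matrix.one_mulVec, Matrix.smul_mulVec, dotProduct_sub, dotProduct_smul,
    star_trivial, smul_eq_mul] at h
  rw [← real_inner_self_eq_norm_sq]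
  simp only [EuclideanSpace.inner_eq_star_dotProduct, star_trivial,
    Matrix.ofLp_toLpLin, Matrix.toLin'_apply]
  linarith

/-- Lemma 7 of the appendix: preconditioned descent inequality. -/
theorem descent_inequality_preconditioned
    (q : ℕ) (F : EuclideanSpace ℝ (Fin q) → ℝ) (L_F : ℝ) (hLF : 0 < L_F)
    (hconv : ConvexOn ℝ Set.univ F) (hdiff : Differentiable ℝ F)
    (hlip : ∀ x y : EuclideanSpace ℝ (Fin q),
      ‖gradient F x - gradient F y‖ ≤ L_F * ‖x - y‖)
    (η : ℝ) (hη : 0 < η)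
    (G : Matrix (Fin q) (Fin q) ℝ) (hG : G.PosDef)
    (hGI : (G - (L_F * η) • (1 : Matrix (Fin q) (Fin q) ℝ)).PosSemidef)
    (d w xk xstar : EuclideanSpace ℝ (Fin q))
    (μ xk1 : EuclideanSpace ℝ (Fin q))
    (hμ : μ = d + w) (hxk1 : xk1 = xk - η • Matrix.toEuclideanLin G⁻¹ μ) :
    -(2 * η) * ⟪μ, xk - xstar⟫ + η ^ 2 * ⟪μ, Matrix.toEuclideanLin G⁻¹ μ⟫
      ≤ -(2 * η) * (F xk1 - F xstar)
        - 2 * η * ⟪d - gradient F xk, xk1 - xstar⟫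
        + 2 * η * ⟪w, xstar - xk1⟫ := by
  have hlow := hconv.add_inner_gradient_le hdiff xk xstar
  have hup := le_add_inner_gradient_add_of_lipschitz_gradient hdiff hlip xk xk1
  have hpre := hG.mul_norm_sq_inv_le_inner hGI μ
  set p := Matrix.toEuclideanLin G⁻¹ μ
  have hstep : xk1 - xk = -(η • p) := by rw [hxk1]; abel
  have hnorm : ‖xk1 - xk‖ ^ 2 = η ^ 2 * ‖p‖ ^ 2 := by
    rw [hstep, norm_neg, norm_smul, mul_pow, Real.norm_eq_abs, sq_abs]
  have hinner : ⟪μ, xk1⟫ = ⟪μ, xk⟫ - η * ⟪μ, p⟫ := by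
    rw [hxk1, inner_sub_right, real_inner_smul_right]
  have hsplit (v : EuclideanSpace ℝ (Fin q)) : ⟪μ, v⟫ = ⟪d, v⟫ + ⟪w, v⟫ := by
    rw [hμ, inner_add_left]
  have hbound := mul_le_mul_of_nonneg_left hpre (sq_nonneg η)
  have hgap : 2 * η * (F xk1 - F xstar - ⟪gradient F xk, xk1 - xstar⟫)
      ≤ η ^ 2 * ⟪μ, p⟫ := by
    rw [hnorm] at hup
    simp only [inner_sub_right] at hlow hup ⊢
    have := mul_le_mul_of_nonneg_left (add_le_add hlow hup) (by positivity : 0 ≤ 2 * η)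
    linarith
  have hxk1_split := hsplit xk1
  have hxstar_split := hsplit xstar
  simp only [inner_sub_left, inner_sub_right] at hgap ⊢
  linear_combination hgap + 2 * η * hinner - 2 * η * hxk1_split + 2 * η * hxstar_split
end
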